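/- Let K be a Killing tensor of type I on an n-dimensional (pseudo-)Riemannian manifold, with orthonormal basis of eigenvector fields {e_a} and corresponding eigenvalue functions {ρ_a}. Then the Killing equation is equivalent to the intrinsic Killing tensor equations: ρ_a s_bca + ρ_b s_cab + ρ_c s_abc = 0 for pairwise distinct a,b,c; e_a² e_b(ρ_a) − (ρ_b − ρ_a) s_aab = 0 for a ≠ b; and e_b(ρ_b) = 0; where s_abc = g(e_c, {e_a,e_b}) are the symmetrized rotation coefficients and {x,y} = ∇_x y + ∇_y x. -/

import Mathlib

/- An algebraic model of the differential geometry of an n-dimensional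
(pseudo-)Riemannian manifold: `F` models the ring of smooth real functions,
`X` the `F`-module of vector fields, `act` the action of vector fields on
functions by derivation, `bracket` the Lie bracket, `g` the metric, `conn`
the Levi-Civita connection and `e`, `eps` a (pseudo-)orthonormal frame
recording the dimension and the signature. -/

noncomputable section

namespace KCT

/-- complex multiplication on pairs of functions -/
def cxMul {F : Type} [CommRing F] (a b : F × F) : F × F :=
  (a.1 * b.1 - a.2 * b.2, a.1 * b.2 + a.2 * b.1)

/-- the imaginary unit -/
def cxI {F : Type} [CommRing F] : F × F := (0, 1)

/-- complex conjugation -/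
def cxConj {F : Type} [CommRing F] (a : F × F) : F × F := (a.1, -a.2)

def cxSmul {F : Type} [CommRing F] (f : F) (a : F × F) : F × F := (f * a.1, f * a.2)

/-- complex inverse (meaningful when the squared modulus is invertible) -/
def cxInv {F : Type} [CommRing F] (a : F × F) : F × F :=
  cxSmul (Ring.inverse (a.1 * a.1 + a.2 * a.2)) (cxConj a)

/-- The underlying (local) smooth manifold: smooth functions `F`,
vector fields `X`, derivations and Lie bracket. -/
structure Man where
  F : Type
  [instCRF : CommRing F]
  [instAlg : Algebra ℝ F]
  X : Type
  [instACG : AddCommGroup X]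
  [instMod : Module F X]
  act : X → F → F
  bracket : X → X → X
  act_addf : ∀ x f₁ f₂, act x (f₁ + f₂) = act x f₁ + act x f₂
  act_mulf : ∀ x f₁ f₂, act x (f₁ * f₂) = act x f₁ * f₂ + f₁ * act x f₂
  act_addv : ∀ x y f, act (x + y) f = act x f + act y f
  act_smulv : ∀ (h : F) x f, act (h • x) f = h * act x f
  act_const : ∀ x r, act x (algebraMap ℝ F r) = 0
  /-- pointwise positivity of a function -/
  Pos : F → Prop
  pos_one : Pos 1
  pos_mul : ∀ f h, Pos f → Pos h → Pos (f * h)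
  pos_unit : ∀ f, Pos f → IsUnit f
  sq_pos : ∀ f, IsUnit f → Pos (f * f)
  /-- the exponential of a function -/
  fexp : F → F
  fexp_unit : ∀ f, IsUnit (fexp f)
  fexp_deriv : ∀ x f, act x (fexp f) = fexp f * act x f
  /-- locally, closed one-forms are exact -/
  closed_exact : ∀ ω : X → F, (∀ (f : F) x, ω (f • x) = f * ω x) →
    (∀ x y, ω (x + y) = ω x + ω y) →
    (∀ x y, act x (ω y) - act y (ω x) - ω (bracket x y) = 0) →
    ∃ f : F, ∀ x, ω x = act x f

attribute [instance] Man.instCRF Man.instAlg Man.instACG Man.instMod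

/-- extension of the derivation action to complex valued functions -/
def Man.cxAct (M : Man) (x : M.X) (f : M.F × M.F) : M.F × M.F := (M.act x f.1, M.act x f.2)

/-- An `n`-dimensional (pseudo-)Riemannian metric on `M` together with its
Levi-Civita connection and a (pseudo-)orthonormal frame. -/
structure Metric (M : Man) (n : ℕ) where
  g : M.X → M.X → M.F
  conn : M.X → M.X → M.X
  e : Fin n → M.X
  eps : Fin n → M.F
  g_symm : ∀ x y, g x y = g y x
  g_addl : ∀ x y z, g (x + y) z = g x z + g y z
  g_smull : ∀ (f : M.F) x y, g (f • x) y = f * g x y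
  conn_addl : ∀ x y z, conn (x + y) z = conn x z + conn y z
  conn_smull : ∀ (f : M.F) x y, conn (f • x) y = f • conn x y
  conn_addr : ∀ x y z, conn x (y + z) = conn x y + conn x z
  conn_leibniz : ∀ x (f : M.F) y, conn x (f • y) = M.act x f • y + f • conn x y
  torsion_free : ∀ x y, conn x y - conn y x = M.bracket x y
  metric_compat : ∀ x y z, M.act x (g y z) = g (conn x y) z + g y (conn x z)
  frame_on : ∀ i j, g (e i) (e j) = if i = j then eps i else 0
  eps_pm : ∀ i, eps i = 1 ∨ eps i = -1
  frame_complete : ∀ x, x = ∑ i, (eps i * g x (e i)) • e i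

namespace Metric

variable {M : Man} {n : ℕ} (G : Metric M n)

/-- `{x,y} = ∇ₓ y + ∇_y x` -/
def sb (x y : M.X) : M.X := G.conn x y + G.conn y x

/-- covariant derivative of a 2-tensor -/
def nabla2 (T : M.X → M.X → M.F) (x y z : M.X) : M.F :=
  M.act x (T y z) - T (G.conn x y) z - T y (G.conn x z)

/-- total symmetrization `∇_(a T_bc)` (cyclic sum) -/
def killingOp (T : M.X → M.X → M.F) (x y z : M.X) : M.F :=
  G.nabla2 T x y z + G.nabla2 T y z x + G.nabla2 T z x y

def Bilin (_G : Metric M n) (T : M.X → M.X → M.F) : Prop :=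
  (∀ (f : M.F) x y, T (f • x) y = f * T x y) ∧ (∀ x y z, T (x + y) z = T x z + T y z) ∧
    (∀ (f : M.F) x y, T x (f • y) = f * T x y) ∧ (∀ x y z, T x (y + z) = T x y + T x z)

def Symm2 (_G : Metric M n) (T : M.X → M.X → M.F) : Prop := ∀ x y, T x y = T y x

/-- second order Killing tensor: `∇_(a K_bc) = 0` -/
def IsKilling (T : M.X → M.X → M.F) : Prop :=
  G.Bilin T ∧ G.Symm2 T ∧ ∀ x y z, G.killingOp T x y z = 0

/-- the total symmetrization `S{g ⊗ t}` -/
def symG (t : M.X → M.F) (x y z : M.X) : M.F :=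
  G.g x y * t z + G.g y z * t x + G.g z x * t y

/-- metric trace of a 2-tensor -/
def tr2 (T : M.X → M.X → M.F) : M.F := ∑ i, G.eps i * T (G.e i) (G.e i)

/-- divergence `(∇·T)_c = ∇^a T_ac` -/
def div2 (T : M.X → M.X → M.F) (z : M.X) : M.F :=
  ∑ i, G.eps i * G.nabla2 T (G.e i) (G.e i) z

/-- the canonical 1-form `t = (2/(n+2)) ∇·T` of the conformal equation -/
def ct (T : M.X → M.X → M.F) (z : M.X) : M.F :=
  algebraMap ℝ M.F (2 / ((n : ℝ) + 2)) * G.div2 T z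

/-- conformal equation with a prescribed 1-form `t` -/
def IsConformalWith (T : M.X → M.X → M.F) (t : M.X → M.F) : Prop :=
  G.Bilin T ∧ G.Symm2 T ∧ ∀ x y z, G.killingOp T x y z = G.symG t x y z

/-- second order conformal tensor: `∇_(a T_bc) = S{g ⊗ t}`, `t = (2/(n+2)) ∇·T` -/
def IsConformal (T : M.X → M.X → M.F) : Prop := G.IsConformalWith T (G.ct T)

/-- the 1-form associated to a vector field -/
def flat (x z : M.X) : M.F := G.g x z

/-- exterior derivative of a 1-form -/
def d1 (_G : Metric M n) (ω : M.X → M.F) (x y : M.X) : M.F :=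
  M.act x (ω y) - M.act y (ω x) - ω (M.bracket x y)

def Closed1 (ω : M.X → M.F) : Prop := ∀ x y, G.d1 ω x y = 0

/-- gradient vector field of a function -/
def grad (f : M.F) : M.X := ∑ i, (G.eps i * M.act (G.e i) f) • G.e i

/-- vector field associated to a 1-form -/
def sharp (ω : M.X → M.F) : M.X := ∑ i, (G.eps i * ω (G.e i)) • G.e i

/-- `x` is an eigenvector field of `T` with eigenvalue function `ρ` -/
def IsEigen (T : M.X → M.X → M.F) (ρ : M.F) (x : M.X) : Prop := ∀ z, T x z = ρ * G.g x z

/-- orthogonal projector onto a (regular) distribution -/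
def IsProjector (v : M.X → M.X) : Prop :=
  (∀ (f : M.F) x, v (f • x) = f • v x) ∧ (∀ x y, v (x + y) = v x + v y) ∧
    (∀ x, v (v x) = v x) ∧ (∀ x y, G.g (v x) y = G.g x (v y))

/-- trace of a projector (= dimension of the distribution) -/
def ptrace (v : M.X → M.X) : M.F := ∑ i, G.eps i * G.g (v (G.e i)) (G.e i)

/-- the complementary (orthogonal) projector -/
def co (_G : Metric M n) (v : M.X → M.X) (x : M.X) : M.X := x - v x

/-- generalized second fundamental form `Q_v(x,y) = h(∇_{v(x)} v(y))` -/
def Qv (v : M.X → M.X) (x y : M.X) : M.X := G.co v (G.conn (v x) (v y))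

/-- umbilical distribution with `S_v = ½ v ⊗ a` -/
def UmbilicalWith (v : M.X → M.X) (a : M.X) : Prop :=
  ∀ x y, G.Qv v x y + G.Qv v y x = G.g (v x) (v y) • a

/-- umbilical distribution of dimension `p` : `S_v = (1/p) v ⊗ Tr S_v` -/
def Umbilical (v : M.X → M.X) (p : ℕ) : Prop :=
  ∀ x y, (p : M.F) • (G.Qv v x y + G.Qv v y x)
    = (2 * G.g (v x) (v y)) • ∑ i, G.eps i • G.Qv v (G.e i) (G.e i)

/-- (totally) geodesic distribution: `S_v = 0` -/
def Geodesic (v : M.X → M.X) : Prop := ∀ x y, G.Qv v x y + G.Qv v y x = 0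

/-- the symmetric 2-tensor `α v + β h` of an almost-product structure -/
def apTensor (v : M.X → M.X) (α β : M.F) (x y : M.X) : M.F :=
  α * G.g (v x) y + β * G.g (x - v x) y

/-- projector on the line spanned by the unitary (`g(u,u) = ε = ±1`) field `u` -/
def uproj (u : M.X) (ε : M.F) (x : M.X) : M.X := (ε * G.g u x) • u

/-- acceleration `u̇ = ∇_u u` -/
def acc (u : M.X) : M.X := G.conn u u

/-- expansion `θ = ∇·u` -/
def expan (u : M.X) : M.F := ∑ i, G.eps i * G.g (G.conn (G.e i) u) (G.e i)

/-- vanishing of the shear `σ` of a unitary vector field `u` -/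
def ShearFree (u : M.X) (ε : M.F) : Prop := ∀ x y,
  G.g (G.conn (G.co (G.uproj u ε) x) u) (G.co (G.uproj u ε) y)
      + G.g (G.conn (G.co (G.uproj u ε) y) u) (G.co (G.uproj u ε) x)
    = algebraMap ℝ M.F (2 / ((n : ℝ) - 1)) * G.expan u
        * G.g (G.co (G.uproj u ε) x) (G.co (G.uproj u ε) y)

/-- condition (i) of Proposition 1: on each eigenspace,
`(T - ρ g){x,y} = g(x,y)(dρ - t)` -/
def CondI (T : M.X → M.X → M.F) (t : M.X → M.F) : Prop :=
  ∀ (ρ : M.F) (x y : M.X), G.IsEigen T ρ x → G.IsEigen T ρ y → ∀ z,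
    T (G.sb x y) z - ρ * G.g (G.sb x y) z = G.g x y * (M.act z ρ - t z)

/-- condition (ii) of Proposition 1 (condition (iii) of Theorem 1):
for eigenvectors with pairwise different eigenvalues,
`T(x,{y,z}) + T(z,{x,y}) + T(y,{z,x}) = 0` -/
def CondIII (T : M.X → M.X → M.F) : Prop :=
  ∀ (ρ₁ ρ₂ ρ₃ : M.F) (x y z : M.X),
    G.IsEigen T ρ₁ x → G.IsEigen T ρ₂ y → G.IsEigen T ρ₃ z →
    IsUnit (ρ₁ - ρ₂) → IsUnit (ρ₂ - ρ₃) → IsUnit (ρ₁ - ρ₃) →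
    T x (G.sb y z) + T z (G.sb x y) + T y (G.sb z x) = 0

/- Curvature -/

def curv (x y z : M.X) : M.X :=
  G.conn x (G.conn y z) - G.conn y (G.conn x z) - G.conn (M.bracket x y) z

def riem (x y z w : M.X) : M.F := G.g (G.curv x y z) w

def ricci (x y : M.X) : M.F := ∑ i, G.eps i * G.riem (G.e i) x y (G.e i)

def scal : M.F := ∑ i, G.eps i * G.ricci (G.e i) (G.e i)

/-- covariant derivative of a 4-tensor -/
def nabla4 (T : M.X → M.X → M.X → M.X → M.F) (x a b c d : M.X) : M.F :=
  M.act x (T a b c d) - T (G.conn x a) b c d - T a (G.conn x b) c d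
    - T a b (G.conn x c) d - T a b c (G.conn x d)

/- Dimension four: Hodge duality, self-dual formalism, Weyl tensor -/

/-- composition (`Tr₂₃`-contraction) of two 2-tensors -/
def comp2 (A B : M.X → M.X → M.F) (x y : M.X) : M.F :=
  ∑ i, G.eps i * A x (G.e i) * B (G.e i) y

end Metric

namespace Metric

variable {M : Man} (G : Metric M 4)

/-- the metric volume element `η` -/
def vol (x0 x1 x2 x3 : M.X) : M.F :=
  ((Matrix.of fun i j => G.eps j * G.g (![x0, x1, x2, x3] i) (G.e j)) :
    Matrix (Fin 4) (Fin 4) M.F).det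

/-- Hodge dual of a 2-form -/
def hodge (U : M.X → M.X → M.F) (x y : M.X) : M.F :=
  algebraMap ℝ M.F (1 / 2) *
    ∑ i, ∑ j, G.eps i * G.eps j * G.vol x y (G.e i) (G.e j) * U (G.e i) (G.e j)

/-- exterior codifferential of a 2-form -/
def codiff2 (U : M.X → M.X → M.F) (z : M.X) : M.F :=
  -∑ i, G.eps i * G.nabla2 U (G.e i) (G.e i) z

/-- the 1-form `i(δU)U` -/
def iD (U : M.X → M.X → M.F) (z : M.X) : M.F := U (G.sharp (G.codiff2 U)) z

/-- `Φ[U] = i(δU)U - i(δ*U)*U` -/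
def Phi (U : M.X → M.X → M.F) (z : M.X) : M.F := G.iD U z - G.iD (G.hodge U) z

/-- the self-dual unitary 2-form `𝒰 = (1/√2)(U - i *U)` -/
def sdU (U : M.X → M.X → M.F) (x y : M.X) : M.F × M.F :=
  (algebraMap ℝ M.F (Real.sqrt 2)⁻¹ * U x y,
    -(algebraMap ℝ M.F (Real.sqrt 2)⁻¹ * G.hodge U x y))

/-- the self-dual metric `𝒢 = ½(G - i η)` -/
def sdG (a b c d : M.X) : M.F × M.F :=
  (algebraMap ℝ M.F (1 / 2) * (G.g a c * G.g b d - G.g a d * G.g b c),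
    -(algebraMap ℝ M.F (1 / 2) * G.vol a b c d))

/-- covariant derivative of a complex 2-tensor -/
def nabla2C (T : M.X → M.X → M.F × M.F) (x y z : M.X) : M.F × M.F :=
  M.cxAct x (T y z) - T (G.conn x y) z - T y (G.conn x z)

/-- codifferential of a complex 2-form -/
def codiff2C (T : M.X → M.X → M.F × M.F) (z : M.X) : M.F × M.F :=
  -∑ i, cxSmul (G.eps i) (G.nabla2C T (G.e i) (G.e i) z)

/-- the (complex) vector field associated with a complex 1-form -/
def sharpC (ω : M.X → M.F × M.F) : M.X × M.X :=
  (G.sharp fun z => (ω z).1, G.sharp fun z => (ω z).2)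

/-- evaluation of a complex 2-form on a complex vector (first slot) -/
def evalC (_G : Metric M 4) (T : M.X → M.X → M.F × M.F) (ξ : M.X × M.X) (z : M.X) : M.F × M.F :=
  T ξ.1 z + cxMul cxI (T ξ.2 z)

/-- interior product of a complex vector with a complex 4-tensor (first slot) -/
def evalC4 (_G : Metric M 4) (A : M.X → M.X → M.X → M.X → M.F × M.F) (ξ : M.X × M.X) (x y z : M.X) :
    M.F × M.F :=
  A ξ.1 x y z + cxMul cxI (A ξ.2 x y z)

/-- `Σ[U] ≡ ∇𝒰 - i(δ𝒰)𝒰 ⊗ 𝒰 - i(δ𝒰)𝒢 = 0` (the umbilical condition) -/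
def SigmaCond (U : M.X → M.X → M.F) : Prop :=
  ∀ x y z, G.nabla2C (G.sdU U) x y z
    = cxMul (G.evalC (G.sdU U) (G.sharpC (G.codiff2C (G.sdU U))) x) (G.sdU U y z)
        + G.evalC4 G.sdG (G.sharpC (G.codiff2C (G.sdU U))) x y z

/-- the Weyl tensor (dimension four) -/
def weyl (a b c d : M.X) : M.F :=
  G.riem a b c d
    - algebraMap ℝ M.F (1 / 2) * (G.g a c * G.ricci b d + G.g b d * G.ricci a c
        - G.g a d * G.ricci b c - G.g b c * G.ricci a d)
    + algebraMap ℝ M.F (1 / 6) * G.scal * (G.g a c * G.g b d - G.g a d * G.g b c)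

/-- Hodge dual of a double 2-form on its first pair of indices -/
def hodgeL (T : M.X → M.X → M.X → M.X → M.F) (a b c d : M.X) : M.F :=
  algebraMap ℝ M.F (1 / 2) *
    ∑ i, ∑ j, G.eps i * G.eps j * G.vol a b (G.e i) (G.e j) * T (G.e i) (G.e j) c d

/-- the self-dual Weyl tensor `𝒲 = ½(W - i *W)` -/
def cWeyl (a b c d : M.X) : M.F × M.F :=
  (algebraMap ℝ M.F (1 / 2) * G.weyl a b c d,
    -(algebraMap ℝ M.F (1 / 2) * G.hodgeL G.weyl a b c d))

/-- composition of complex double 2-forms (as endomorphisms of bivectors) -/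
def compW (A B : M.X → M.X → M.X → M.X → M.F × M.F) (a b c d : M.X) : M.F × M.F :=
  cxSmul (algebraMap ℝ M.F (1 / 2))
    (∑ i, ∑ j, cxSmul (G.eps i * G.eps j)
      (cxMul (A a b (G.e i) (G.e j)) (B (G.e i) (G.e j) c d)))

/-- trace of a complex double 2-form (as an endomorphism of bivectors) -/
def trW (A : M.X → M.X → M.X → M.X → M.F × M.F) : M.F × M.F :=
  cxSmul (algebraMap ℝ M.F (1 / 2))
    (∑ i, ∑ j, cxSmul (G.eps i * G.eps j) (A (G.e i) (G.e j) (G.e i) (G.e j)))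

/-- the double Weyl eigenvalue `ρ = -Tr 𝒲³ / Tr 𝒲²` -/
def rhoWeyl : M.F × M.F :=
  -(cxMul (cxInv (G.trW (G.compW G.cWeyl G.cWeyl)))
      (G.trW (G.compW (G.compW G.cWeyl G.cWeyl) G.cWeyl)))

/-- the concomitant `𝒮 = (1/(3ρ))(𝒲 - ρ 𝒢)` -/
def sWeyl (a b c d : M.X) : M.F × M.F :=
  cxMul (cxInv (cxSmul 3 G.rhoWeyl)) (G.cWeyl a b c d - cxMul G.rhoWeyl (G.sdG a b c d))

/-- divergence-free Weyl tensor (vanishing Cotton tensor): `δW = 0` -/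
def DivFreeWeyl : Prop :=
  ∀ b c d, ∑ i, G.eps i * G.nabla4 G.weyl (G.e i) (G.e i) b c d = 0

/-- the bivector image `A(X)` of a bivector by a double 2-form -/
def sContract (A : M.X → M.X → M.X → M.X → M.F × M.F) (Xb : M.X → M.X → M.F × M.F)
    (x y : M.X) : M.F × M.F :=
  cxSmul (algebraMap ℝ M.F (1 / 2))
    (∑ i, ∑ j, cxSmul (G.eps i * G.eps j)
      (cxMul (A x y (G.e i) (G.e j)) (Xb (G.e i) (G.e j))))

/-- the scalar `A(X,X)` -/
def sNorm (A : M.X → M.X → M.X → M.X → M.F × M.F) (Xb : M.X → M.X → M.F × M.F) :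
    M.F × M.F :=
  cxSmul (algebraMap ℝ M.F (1 / 2))
    (∑ i, ∑ j, cxSmul (G.eps i * G.eps j)
      (cxMul (G.sContract A Xb (G.e i) (G.e j)) (Xb (G.e i) (G.e j))))

/-- self-dual complex bivector: `*𝒳 = i 𝒳` -/
def SelfDualC (Xb : M.X → M.X → M.F × M.F) : Prop :=
  ∀ x y, ((G.hodge fun a b => (Xb a b).1) x y, (G.hodge fun a b => (Xb a b).2) x y)
    = cxMul cxI (Xb x y)

/-- Lorentzian signature (-+++) -/
def Lorentz : Prop := G.eps 0 = -1 ∧ G.eps 1 = 1 ∧ G.eps 2 = 1 ∧ G.eps 3 = 1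

end Metric


namespace Man

variable (M : Man)

lemma act_zero (x : M.X) : M.act x 0 = 0 := by
  simpa using M.act_const x 0

lemma act_of_sign {x : M.X} {f : M.F} (hf : f = 1 ∨ f = -1) : M.act x f = 0 := by
  rcases hf with rfl | rfl
  · simpa using M.act_const x 1
  · simpa using M.act_const x (-1)

lemma eq_zero_of_natCast_mul {k : ℕ} (hk : k ≠ 0) {f : M.F} (h : (k : M.F) * f = 0) :
    f = 0 := by
  have hinv : algebraMap ℝ M.F (k : ℝ)⁻¹ * k = 1 := by
    rw [← map_natCast (algebraMap ℝ M.F) k, ← map_mul, inv_mul_cancel₀ (Nat.cast_ne_zero.2 hk),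
      map_one]
  rw [← one_mul f, ← hinv, mul_assoc, h, mul_zero]

end Man

namespace Metric

variable {M : Man} {n : ℕ} (G : Metric M n)

lemma g_addr (x y z : M.X) : G.g x (y + z) = G.g x y + G.g x z := by
  rw [G.g_symm, G.g_addl, G.g_symm y, G.g_symm z]

lemma killingOp_cyclic (T : M.X → M.X → M.F) (x y z : M.X) :
    G.killingOp T x y z = G.killingOp T y z x := by
  unfold killingOp
  ring

lemma killingOp_add {T : M.X → M.X → M.F} (hT : G.Bilin T) (x x' y z : M.X) :
    G.killingOp T (x + x') y z = G.killingOp T x y z + G.killingOp T x' y z := by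
  obtain ⟨-, hl, -, hr⟩ := hT
  simp only [killingOp, nabla2, M.act_addv, G.conn_addl, G.conn_addr, hl, hr, M.act_addf]
  ring

lemma killingOp_smul {T : M.X → M.X → M.F} (hT : G.Bilin T) (f : M.F) (x y z : M.X) :
    G.killingOp T (f • x) y z = f * G.killingOp T x y z := by
  obtain ⟨hls, hl, hrs, hr⟩ := hT
  simp only [killingOp, nabla2, M.act_smulv, G.conn_smull, G.conn_leibniz, hl, hr, hls, hrs,
    M.act_mulf]
  ring

lemma killingOp_eq_zero_of_frame {T : M.X → M.X → M.F} (hT : G.Bilin T)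
    {ι : Type*} [Fintype ι] {u : ι → M.X}
    (hu : ∀ x, ∃ c : ι → M.F, x = ∑ i, c i • u i) {y z : M.X}
    (h : ∀ i, G.killingOp T (u i) y z = 0) (x : M.X) : G.killingOp T x y z = 0 := by
  let φ : M.X →ₗ[M.F] M.F :=
    { toFun := fun x => G.killingOp T x y z
      map_add' := fun x x' => G.killingOp_add hT x x' y z
      map_smul' := fun f x => G.killingOp_smul hT f x y z }
  obtain ⟨c, rfl⟩ := hu x
  change φ (∑ i, c i • u i) = 0
  rw [map_sum]
  refine Finset.sum_eq_zero fun i _ => ?_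
  rw [map_smul, show φ (u i) = 0 from h i, smul_zero]

lemma killingOp_eq_zero_iff_frame {T : M.X → M.X → M.F} (hT : G.Bilin T)
    {ι : Type*} [Fintype ι] {u : ι → M.X}
    (hu : ∀ x, ∃ c : ι → M.F, x = ∑ i, c i • u i) :
    (∀ x y z, G.killingOp T x y z = 0) ↔
      ∀ i j k, G.killingOp T (u i) (u j) (u k) = 0 := by
  refine ⟨fun h i j k => h _ _ _, fun h x y z => ?_⟩
  refine G.killingOp_eq_zero_of_frame hT hu (fun i => ?_) x
  rw [killingOp_cyclic]
  refine G.killingOp_eq_zero_of_frame hT hu (fun j => ?_) y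
  rw [killingOp_cyclic]
  refine G.killingOp_eq_zero_of_frame hT hu (fun k => ?_) z
  rw [killingOp_cyclic]
  exact h i j k

/-- The Killing operator on three eigenvector fields. -/
lemma killingOp_of_isEigen {T : M.X → M.X → M.F} (hsym : G.Symm2 T) {x y z : M.X}
    {α β γ : M.F} (hx : G.IsEigen T α x) (hy : G.IsEigen T β y) (hz : G.IsEigen T γ z) :
    G.killingOp T x y z =
      M.act x (β * G.g y z) + M.act y (γ * G.g z x) + M.act z (α * G.g x y)
        - (α * G.g x (G.sb y z) + β * G.g y (G.sb z x) + γ * G.g z (G.sb x y)) := by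
  simp only [killingOp, nabla2, sb, g_addr, hsym (G.conn _ _), hx _, hy _, hz _]
  ring

/-- A field of constant norm is orthogonal to its derivatives. -/
lemma g_conn_self_of_sign {x y : M.X} (hx : G.g x x = 1 ∨ G.g x x = -1) :
    G.g x (G.conn y x) = 0 := by
  refine M.eq_zero_of_natCast_mul two_ne_zero ?_
  have h := G.metric_compat y x x
  rw [M.act_of_sign hx, G.g_symm (G.conn y x)] at h
  push_cast
  linear_combination -h

/-- For a unit field `x` orthogonal to `y`, `2 g(x, {x,y}) = -g(y, {x,x})`. -/
lemma two_mul_g_sb {x y : M.X} (hx : G.g x x = 1 ∨ G.g x x = -1) (hxy : G.g x y = 0) :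
    2 * G.g x (G.sb x y) = -G.g y (G.sb x x) := by
  have h := G.metric_compat x x y
  rw [hxy, M.act_zero, G.g_symm (G.conn x x)] at h
  simp only [sb, g_addr, G.g_conn_self_of_sign hx]
  linear_combination -2 * h

lemma sb_comm (x y : M.X) : G.sb x y = G.sb y x := add_comm _ _

lemma killingOp_self_left {T : M.X → M.X → M.F} (hsym : G.Symm2 T) {x y : M.X} {α β : M.F}
    (hx : G.IsEigen T α x) (hy : G.IsEigen T β y)
    (hxx : G.g x x = 1 ∨ G.g x x = -1) (hxy : G.g x y = 0) :
    G.killingOp T x x y = G.g x x * M.act y α - (β - α) * G.g y (G.sb x x) := by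
  rw [G.killingOp_of_isEigen hsym hx hx hy, G.g_symm y x, hxy, mul_zero, mul_zero, M.act_zero,
    M.act_mulf, M.act_of_sign hxx, G.sb_comm y x]
  linear_combination -α * G.two_mul_g_sb hxx hxy

lemma killingOp_self {T : M.X → M.X → M.F} (hsym : G.Symm2 T) {x : M.X} {α : M.F}
    (hx : G.IsEigen T α x) (hxx : G.g x x = 1 ∨ G.g x x = -1) :
    G.killingOp T x x x = 3 * (G.g x x * M.act x α) := by
  rw [G.killingOp_of_isEigen hsym hx hx hx, M.act_mulf, M.act_of_sign hxx]
  simp only [sb, g_addr, G.g_conn_self_of_sign hxx]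
  ring

end Metric

/-- the Killing equation for a type I tensor is equivalent to the
Eisenhart intrinsic Killing tensor equations in terms of the eigenvalues and the
symmetrized rotation coefficients of an orthonormal eigenframe. -/
theorem stmt_6 {M : Man} {n : ℕ} (G : Metric M n) (K : M.X → M.X → M.F)
    (hbil : G.Bilin K) (hsym : G.Symm2 K)
    (e' : Fin n → M.X) (eps' ρ : Fin n → M.F)
    (hon : ∀ i j, G.g (e' i) (e' j) = if i = j then eps' i else 0)
    (hpm : ∀ i, eps' i = 1 ∨ eps' i = -1)
    (hcomp : ∀ x, x = ∑ i, (eps' i * G.g x (e' i)) • e' i)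
    (heig : ∀ i, G.IsEigen K (ρ i) (e' i))
    (s : Fin n → Fin n → Fin n → M.F)
    (hs : ∀ a b c, s a b c = G.g (e' c) (G.sb (e' a) (e' b))) :
    (∀ x y z, G.killingOp K x y z = 0) ↔
      ((∀ a b c, a ≠ b → b ≠ c → a ≠ c →
          ρ a * s b c a + ρ b * s c a b + ρ c * s a b c = 0) ∧
        (∀ a b, a ≠ b →
          eps' a * M.act (e' b) (ρ a) - (ρ b - ρ a) * s a a b = 0) ∧
        (∀ b, M.act (e' b) (ρ b) = 0)) := by
  have hnorm : ∀ a, G.g (e' a) (e' a) = eps' a := fun a => by simp [hon]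
  have hunit : ∀ a, G.g (e' a) (e' a) = 1 ∨ G.g (e' a) (e' a) = -1 := fun a => by
    rw [hnorm]
    exact hpm a
  have horth : ∀ {a b}, a ≠ b → G.g (e' a) (e' b) = 0 := fun h => by simp [hon, h]
  have hdist : ∀ {a b c}, a ≠ b → b ≠ c → a ≠ c →
      G.killingOp K (e' a) (e' b) (e' c) =
        -(ρ a * s b c a + ρ b * s c a b + ρ c * s a b c) := fun hab hbc hac => by
    rw [G.killingOp_of_isEigen hsym (heig _) (heig _) (heig _), horth hab, horth hbc,
      horth hac.symm]
    simp only [mul_zero, M.act_zero, hs]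
    ring
  have htwo : ∀ {a b}, a ≠ b → G.killingOp K (e' a) (e' a) (e' b) =
      eps' a * M.act (e' b) (ρ a) - (ρ b - ρ a) * s a a b := fun {a b} hab => by
    rw [G.killingOp_self_left hsym (heig a) (heig b) (hunit a) (horth hab), hnorm, hs]
  have hone : ∀ a, G.killingOp K (e' a) (e' a) (e' a) =
      3 * (eps' a * M.act (e' a) (ρ a)) := fun a => by
    rw [G.killingOp_self hsym (heig a) (hunit a), hnorm]
  rw [G.killingOp_eq_zero_iff_frame hbil fun x => ⟨_, hcomp x⟩]
  constructor
  · intro h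
    refine ⟨fun a b c hab hbc hac => ?_, fun a b hab => ?_, fun b => ?_⟩
    · rw [← neg_eq_zero, ← hdist hab hbc hac, h]
    · rw [← htwo hab, h]
    · have hb := M.eq_zero_of_natCast_mul three_ne_zero
        (by exact_mod_cast (hone b).symm.trans (h b b b))
      rcases hpm b with hε | hε <;> simpa [hε] using hb
  · rintro ⟨h1, h2, h3⟩
    have hpair : ∀ a b, G.killingOp K (e' a) (e' a) (e' b) = 0 := fun a b => by
      rcases eq_or_ne a b with rfl | hab
      · rw [hone, h3, mul_zero, mul_zero]
      · rw [htwo hab, h2 a b hab]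
    intro a b c
    rcases eq_or_ne a b with rfl | hab
    · exact hpair a c
    rcases eq_or_ne b c with rfl | hbc
    · rw [G.killingOp_cyclic]
      exact hpair b a
    rcases eq_or_ne a c with rfl | hac
    · rw [← G.killingOp_cyclic]
      exact hpair a b
    rw [hdist hab hbc hac, h1 a b c hab hbc hac, neg_zero]

end KCT
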